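/- arXiv:1902.08007 — 6 statements merged into one kernel-verified Lean document; each statement's English description precedes it below -/
import Mathlib

section
/- For every integer q ≥ 2 there exists an integer n ≥ 2 such that no automata network f : [q]^{n+1} → [q]^{n+1} whose interaction graph is G_n is expansive. Since G_n is strong and coverable, this shows that for every q there exists a strong and coverable directed graph admitting no expansive network over the alphabet [q]. -/
/-- Arc `u → v` of the interaction graph of the automata network `f`:
`f_v` depends essentially on coordinate `u`. -/
def hasArc {m : ℕ} {α : Type*} (f : (Fin m → α) → (Fin m → α)) (u v : Fin m) : Prop :=
  ∃ a b : Fin m → α, (∀ w : Fin m, w ≠ u → a w = b w) ∧ f a v ≠ f b v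

/-- An automata network `f` is *expansive* if for all distinct configurations `x, y`
and every node `v` there exists `t ≥ 1` with `f^t(x)_v ≠ f^t(y)_v`. -/
def Expansive {m : ℕ} {α : Type*} (f : (Fin m → α) → (Fin m → α)) : Prop :=
  ∀ x y : Fin m → α, x ≠ y → ∀ v : Fin m, ∃ t : ℕ, 1 ≤ t ∧ f^[t] x v ≠ f^[t] y v

/-- The graph `G_n` on vertex set `{0, 1, …, n}` with arcs `(0,i)`, `(i,0)` and `(i,i)`
for all `0 ≤ i ≤ n`. -/
def Gn (n : ℕ) : Fin (n + 1) → Fin (n + 1) → Prop :=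
  fun i j => i = 0 ∨ j = 0 ∨ i = j

theorem eq_of_forall_hasArc {m : ℕ} {α : Type*} (f : (Fin m → α) → (Fin m → α)) (v : Fin m)
    (a b : Fin m → α) (h : ∀ u, hasArc f u v → a u = b u) : f a v = f b v := by
  classical
  have key : ∀ s : Finset (Fin m), f (fun w => if w ∈ s then b w else a w) v = f a v := by
    intro s
    induction s using Finset.induction_on with
    | empty => simp
    | insert u s _ ih =>
      rw [← ih]
      by_cases hu : hasArc f u v
      · congr 1
        funext w
        by_cases hw : w = u
        · subst hw
          simp [h w hu]
        · simp [hw]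
      · by_contra hne
        refine hu ⟨_, _, fun w hw => ?_, hne⟩
        simp [hw]
  simpa using (key Finset.univ).symm

theorem Expansive.injective {m : ℕ} {α : Type*} {f : (Fin m → α) → (Fin m → α)}
    (hf : Expansive f) (v : Fin m) : Function.Injective f := by
  intro x y hxy
  by_contra hne
  obtain ⟨t, ht, hd⟩ := hf x y hne v
  obtain ⟨s, rfl⟩ := Nat.exists_eq_add_of_le' ht
  exact hd (by rw [Function.iterate_succ_apply, Function.iterate_succ_apply, hxy])

/-- If every orbit has period `P`, the trace of length `P` at a node determines the configuration,
which bounds the number of nodes. -/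
theorem Expansive.card_le_of_isPeriodicPt {m q P : ℕ} (hq : 2 ≤ q) (hP : 0 < P)
    {f : (Fin m → Fin q) → (Fin m → Fin q)} (hf : Expansive f) (v : Fin m)
    (hper : ∀ x, Function.IsPeriodicPt f P x) : m ≤ P := by
  have hinj : Function.Injective (fun (x : Fin m → Fin q) (t : Fin P) => f^[t] x v) := by
    intro x y hxy
    by_contra hne
    obtain ⟨t, -, hd⟩ := hf x y hne v
    apply hd
    rw [← (hper x).iterate_mod_apply, ← (hper y).iterate_mod_apply]
    exact congrFun hxy ⟨t % P, Nat.mod_lt _ hP⟩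
  have hcard := Fintype.card_le_of_injective _ hinj
  simp only [Fintype.card_fun, Fintype.card_fin] at hcard
  exact (Nat.pow_le_pow_iff_right (by omega)).1 hcard

/-- The state at a given time of a leaf following the local rule `g` and started in a given state,
when the hub follows the sequence `a`. -/
def leafState {α : Type*} (a : ℕ → α) : ℕ → (α → α → α) → α → α
  | 0, _, b => b
  | t + 1, g, b => g (leafState a t g b) (a t)

theorem iterate_eq_leafState {n : ℕ} {α : Type*} {f : (Fin (n + 1) → α) → (Fin (n + 1) → α)}
    (hf : ∀ u v, hasArc f u v → Gn n u v) (x : Fin (n + 1) → α) {i : Fin (n + 1)} (hi : i ≠ 0)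
    (t : ℕ) :
    f^[t] x i = leafState (fun s => f^[s] x 0) t
      (fun b a => f (fun w => if w = 0 then a else b) i) (x i) := by
  induction t with
  | zero => rfl
  | succ t ih =>
    rw [Function.iterate_succ_apply', leafState, ← ih]
    refine eq_of_forall_hasArc f i _ _ fun u hu => ?_
    rcases hf u i hu with rfl | h | rfl
    · simp
    · exact absurd h hi
    · simp [hi]

/-- A bound on the orbit lengths of injective networks with interaction graph `G_n` that does not
depend on `n`. -/
theorem isPeriodicPt_factorial_of_Gn {n : ℕ} {α : Type*} [Fintype α] [DecidableEq α]
    {f : (Fin (n + 1) → α) → (Fin (n + 1) → α)} (hf : ∀ u v, hasArc f u v → Gn n u v)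
    (hinj : Function.Injective f) (x : Fin (n + 1) → α) :
    Function.IsPeriodicPt f (Fintype.card (α × ((α → α → α) → α → α))).factorial x := by
  set C := Fintype.card (α × ((α → α → α) → α → α)) with hC
  let a : ℕ → α := fun s => f^[s] x 0
  obtain ⟨s, t, hne, hst⟩ := Fintype.exists_ne_map_eq_of_card_lt
    (fun t : Fin (C + 1) => (a t, leafState a t)) (by rw [Fintype.card_fin]; omega)
  wlog hlt : s < t generalizing s t
  · exact this t s hne.symm hst.symm (lt_of_le_of_ne (not_lt.1 hlt) hne.symm)
  obtain ⟨h0, hleaf⟩ := Prod.mk.inj hst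
  have heq : f^[s] x = f^[t] x := by
    funext i
    by_cases hi : i = 0
    · subst hi
      exact h0
    · rw [iterate_eq_leafState hf x hi, iterate_eq_leafState hf x hi]
      exact congrFun (congrFun hleaf _) _
  have hlt' : (s : ℕ) < t := hlt
  have hper : Function.IsPeriodicPt f (t - s) x := by
    apply hinj.iterate s
    rw [← Function.iterate_add_apply, Nat.add_sub_cancel' hlt'.le, heq]
  exact hper.trans_dvd (Nat.dvd_factorial (by omega) (by omega))

/-- Theorem: for every `q ≥ 2` there exists `n ≥ 2` such that the graph `G_n` is strong
and coverable, yet no automata network over the alphabet `[q]` with interaction graph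
`G_n` is expansive. -/
theorem stmt_9 (q : ℕ) (hq : 2 ≤ q) :
    ∃ n : ℕ, 2 ≤ n ∧
      (∀ u v : Fin (n + 1), Relation.ReflTransGen (Gn n) u v) ∧
      (∃ π : Equiv.Perm (Fin (n + 1)), ∀ v : Fin (n + 1), Gn n v (π v)) ∧
      ∀ f : (Fin (n + 1) → Fin q) → (Fin (n + 1) → Fin q),
        (∀ u v : Fin (n + 1), hasArc f u v ↔ Gn n u v) → ¬ Expansive f := by
  set P := (Fintype.card (Fin q × ((Fin q → Fin q → Fin q) → Fin q → Fin q))).factorial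
  refine ⟨P + 2, by omega, fun u v => ?_, ⟨1, fun v => Or.inr (Or.inr rfl)⟩, fun f hf hexp => ?_⟩
  · have hu : Gn (P + 2) u 0 := Or.inr (Or.inl rfl)
    have hv : Gn (P + 2) 0 v := Or.inl rfl
    exact (Relation.ReflTransGen.single hu).tail hv
  · have := hexp.card_le_of_isPeriodicPt hq (Nat.factorial_pos _) 0
      (isPeriodicPt_factorial_of_Gn (fun u v => (hf u v).1) (hexp.injective 0))
    omega
end

section
/- Let q ≥ 2 and let n be an integer with n > q^{2·log₂ q}. Then for every finite abelian group A of order q, there is no additive group endomorphism f of A^{n+1} whose interaction graph is G_n and which is expansive. -/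
/-- A finite abelian group `A` is generated by a set of at most `log₂ |A|` elements. -/
theorem exists_finset_closure_eq_top_two_pow_card_le (A : Type*) [AddCommGroup A] [Finite A] :
    ∃ S : Finset A, AddSubgroup.closure (S : Set A) = ⊤ ∧ 2 ^ S.card ≤ Nat.card A := by
  classical
  let P : Set (AddSubgroup A) := {H | ∃ S : Finset A,
    AddSubgroup.closure (S : Set A) = H ∧ 2 ^ S.card ≤ Nat.card H}
  have hP : P.Nonempty := ⟨⊥, ∅, by simp, by simp⟩
  obtain ⟨H, hmax⟩ := P.toFinite.exists_maximal hP
  obtain ⟨S, hS, hcard⟩ := hmax.prop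
  by_cases hH : H = ⊤
  · exact ⟨S, hS.trans hH, by simpa [hH] using hcard⟩
  obtain ⟨x, hx⟩ : ∃ x, x ∉ H := by
    by_contra! h
    exact hH (AddSubgroup.eq_top_iff' H |>.2 h)
  let K := AddSubgroup.closure ((insert x S : Finset A) : Set A)
  have hHK : H ≤ K := hS ▸ AddSubgroup.closure_mono (by simp)
  have hxK : x ∈ K := AddSubgroup.subset_closure (by simp)
  have hlt : Nat.card H < Nat.card K :=
    Set.ncard_lt_ncard (s := (H : Set A)) (t := (K : Set A)) ⟨hHK, fun h => hx (h hxK)⟩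
  have hdouble : 2 * Nat.card H ≤ Nat.card K := by
    obtain ⟨c, hc⟩ := AddSubgroup.card_dvd_of_le hHK
    have : 2 ≤ c := by
      by_contra! h
      interval_cases c <;> omega
    rw [hc, mul_comm]
    gcongr
  have hK : K ∈ P := by
    refine ⟨insert x S, rfl, ?_⟩
    calc 2 ^ (insert x S).card ≤ 2 ^ (S.card + 1) :=
          Nat.pow_le_pow_right (by norm_num) (Finset.card_insert_le x S)
      _ ≤ Nat.card K := by rw [pow_succ]; omega
  exact absurd (hmax.le_of_ge hK hHK hxK) hx

/-- If two distinct nodes `i, j` other than `0` act identically on themselves and on `0`, and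
have no arcs to any other node, then an additive network is not expansive. -/
theorem not_expansive_of_twins {m : ℕ} {A : Type*} [AddCommGroup A] [Nontrivial A]
    (F : (Fin m → A) →+ (Fin m → A)) {o i j : Fin m} (hij : i ≠ j) (hi : i ≠ o) (hj : j ≠ o)
    (ho : ∀ a, F (Pi.single i a) o = F (Pi.single j a) o)
    (hd : ∀ a, F (Pi.single i a) i = F (Pi.single j a) j)
    (hi0 : ∀ a w, w ≠ o → w ≠ i → F (Pi.single i a) w = 0)
    (hj0 : ∀ a w, w ≠ o → w ≠ j → F (Pi.single j a) w = 0) :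
    ¬ Expansive F := by
  intro h
  have step (a : A) : F (Pi.single i a - Pi.single j a) =
      Pi.single i (F (Pi.single i a) i) - Pi.single j (F (Pi.single i a) i) := by
    ext w
    rw [map_sub, Pi.sub_apply, Pi.sub_apply]
    by_cases hwo : w = o
    · subst hwo
      simp [ho, hi.symm, hj.symm]
    by_cases hwi : w = i
    · subst hwi
      simp [hij, hj0 _ _ hwo hij]
    by_cases hwj : w = j
    · subst hwj
      simp [hwi, hi0 _ _ hwo hwi, hd]
    simp [hwi, hwj, hi0 _ _ hwo hwi, hj0 _ _ hwo hwj]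
  have orbit (t : ℕ) : ∀ a : A, ∃ b : A,
      F^[t] (Pi.single i a - Pi.single j a) = Pi.single i b - Pi.single j b := by
    induction t with
    | zero => exact fun a => ⟨a, rfl⟩
    | succ t ih =>
      intro a
      rw [Function.iterate_succ_apply, step]
      exact ih _
  obtain ⟨a, ha⟩ := exists_ne (0 : A)
  have hne : (Pi.single i a - Pi.single j a : Fin m → A) ≠ 0 := by
    intro h0
    have := congrFun h0 i
    simp [hij, ha] at this
  obtain ⟨t, -, ht⟩ := h _ _ hne o
  obtain ⟨b, hb⟩ := orbit t a
  apply ht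
  rw [hb, iterate_map_zero]
  simp [hi.symm, hj.symm]

/-- Theorem: for `q ≥ 2` and `n > q^{2 log₂ q}`, no abelian network (additive group
endomorphism of `A^{n+1}` for a finite abelian group `A` of order `q`) with interaction
graph `G_n` is expansive. -/
theorem stmt_10 (q n : ℕ) (hq : 2 ≤ q)
    (hn : (q : ℝ) ^ (2 * Real.logb 2 q) < (n : ℝ))
    (A : Type) [AddCommGroup A] [Fintype A] (hA : Fintype.card A = q)
    (f : (Fin (n + 1) → A) → (Fin (n + 1) → A))
    (hadd : ∀ x y : Fin (n + 1) → A, f (x + y) = f x + f y)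
    (hgraph : ∀ u v : Fin (n + 1), hasArc f u v ↔ Gn n u v) :
    ¬ Expansive f := by
  classical
  obtain ⟨S, hS, hScard⟩ := exists_finset_closure_eq_top_two_pow_card_le A
  rw [Nat.card_eq_fintype_card, hA] at hScard
  have : Nontrivial A := Fintype.one_lt_card_iff_nontrivial.1 (by omega)
  let F : (Fin (n + 1) → A) →+ (Fin (n + 1) → A) := AddMonoidHom.mk' f hadd
  have hlog : (S.card : ℝ) ≤ Real.logb 2 q := by
    rw [Real.le_logb_iff_rpow_le (by norm_num) (by positivity), Real.rpow_natCast]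
    exact_mod_cast hScard
  have hpow : q ^ (2 * S.card) < n := by
    have : (q : ℝ) ^ ((2 * S.card : ℕ) : ℝ) < n := by
      refine lt_of_le_of_lt (Real.rpow_le_rpow_of_exponent_le ?_ ?_) hn
      · exact_mod_cast (by omega : 1 ≤ q)
      · push_cast
        linarith
    rw [Real.rpow_natCast] at this
    exact_mod_cast this
  let g : Fin n → (S → A) × (S → A) := fun k =>
    (fun s => F (Pi.single k.succ s.1) 0, fun s => F (Pi.single k.succ s.1) k.succ)
  obtain ⟨k, l, hkl, hg⟩ := Fintype.exists_ne_map_eq_of_card_lt g (by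
    simpa [hA, ← pow_add, ← two_mul] using hpow)
  have hext (u v : Fin (n + 1))
      (h : ∀ s : S, F (Pi.single k.succ s.1) u = F (Pi.single l.succ s.1) v) (a : A) :
      F (Pi.single k.succ a) u = F (Pi.single l.succ a) v := by
    let φ (i w : Fin (n + 1)) : A →+ A :=
      (Pi.evalAddMonoidHom (fun _ => A) w).comp (F.comp (AddMonoidHom.single (fun _ => A) i))
    have : φ k.succ u = φ l.succ v :=
      AddMonoidHom.eq_of_eqOn_dense hS fun s hs => h ⟨s, hs⟩
    exact DFunLike.congr_fun this a
  have hzero (i : Fin (n + 1)) (hi : i ≠ 0) (a : A) (w : Fin (n + 1)) (hw : w ≠ 0)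
      (hwi : w ≠ i) : F (Pi.single i a) w = 0 := by
    by_contra hne
    have harc : hasArc f i w :=
      ⟨Pi.single i a, 0, fun v hv => by simp [hv], fun h => hne (h.trans (congrFun F.map_zero w))⟩
    rcases (hgraph i w).1 harc with h | h | h
    exacts [hi h, hw h, hwi h.symm]
  exact not_expansive_of_twins F (o := 0) (fun h => hkl (Fin.succ_injective _ h))
    (Fin.succ_ne_zero k) (Fin.succ_ne_zero l)
    (hext _ _ fun s => congrFun (congrArg Prod.fst hg) s)
    (hext _ _ fun s => congrFun (congrArg Prod.snd hg) s)
    (hzero _ (Fin.succ_ne_zero k)) (hzero _ (Fin.succ_ne_zero l))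
end

section
/- Let q ≥ 2 and let n be an integer with n > (q−1)². Then there is no matrix M over the ring Z_q = Z/qZ, indexed by the vertex set {0,1,…,n}, such that M_{i,j} ≠ 0 iff (i,j) is an arc of G_n and such that the linear network x ↦ xM on (Z_q)^{n+1} is expansive. -/
/-- If two distinct non-central vertices `i`, `j` have the same loop weight and the same weight
towards `0`, then `e_i - e_j` is an eigenvector of `x ↦ xM`. -/
theorem vecMul_single_sub_single {R : Type*} [Ring R] {n : ℕ}
    {M : Matrix (Fin (n + 1)) (Fin (n + 1)) R} (hM : ∀ i j, ¬ Gn n i j → M i j = 0)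
    {i j : Fin (n + 1)} (hi : i ≠ 0) (hj : j ≠ 0)
    (hdiag : M i i = M j j) (hzero : M i 0 = M j 0) :
    Matrix.vecMul (Pi.single i 1 - Pi.single j 1) M =
      M i i • (Pi.single i 1 - Pi.single j 1 : Fin (n + 1) → R) := by
  ext k
  have row : ∀ l : Fin (n + 1), l ≠ 0 → k ≠ 0 → l ≠ k → M l k = 0 :=
    fun l hl hk hlk => hM l k (by simp [Gn, hl, hk, hlk])
  rw [Matrix.sub_vecMul, Matrix.single_one_vecMul, Matrix.single_one_vecMul]
  simp only [Pi.sub_apply, Pi.smul_apply, smul_eq_mul, Matrix.row_apply, Pi.single_apply]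
  by_cases hk : k = 0
  · subst hk
    simp [hzero, hi.symm, hj.symm]
  · by_cases hki : k = i <;> by_cases hkj : k = j
    · subst hki hkj; simp
    · subst hki; simp [hkj, row j hj hk (Ne.symm hkj)]
    · subst hkj; simp [hki, row i hi hk (Ne.symm hki), hdiag]
    · simp [hki, hkj, row i hi hk (Ne.symm hki), row j hj hk (Ne.symm hkj)]

/-- Corollary: for `q ≥ 2` and `n > (q-1)²`, there is no matrix `M` over `ℤ/qℤ`
(indexed by the vertex set `{0, …, n}`) whose support is exactly the arc set of `G_n`
and such that the linear network `x ↦ xM` is expansive. -/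
theorem stmt_11 (q n : ℕ) (hq : 2 ≤ q) (hn : (q - 1) ^ 2 < n) :
    ¬ ∃ M : Matrix (Fin (n + 1)) (Fin (n + 1)) (ZMod q),
        (∀ i j : Fin (n + 1), M i j ≠ 0 ↔ Gn n i j) ∧
        Expansive (fun x => Matrix.vecMul x M) := by
  rintro ⟨M, hM, hexp⟩
  have : NeZero q := ⟨by omega⟩
  have : Fact (1 < q) := ⟨hq⟩
  have hM0 : ∀ i j, ¬ Gn n i j → M i j = 0 := fun i j h => by
    by_contra h'
    exact h ((hM i j).1 h')
  obtain ⟨i, -, j, -, hij, heq⟩ := Finset.exists_ne_map_eq_of_card_lt_of_maps_to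
    (s := (Finset.univ : Finset (Fin n)))
    (t := ({0}ᶜ : Finset (ZMod q)) ×ˢ ({0}ᶜ : Finset (ZMod q)))
    (f := fun i => (M i.succ i.succ, M i.succ 0))
    (by simpa [Finset.card_compl, ZMod.card, ← sq] using hn)
    (fun i _ => by simp [(hM i.succ i.succ).2 (by simp [Gn]), (hM i.succ 0).2 (by simp [Gn])])
  obtain ⟨hdiag, hzero⟩ := Prod.mk.inj heq
  have hij' : i.succ ≠ j.succ := fun h => hij (Fin.succ_injective n h)
  set x : Fin (n + 1) → ZMod q := Pi.single i.succ 1 - Pi.single j.succ 1 with hx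
  have hx0 : x ≠ 0 := fun h => by
    simpa [hx, Pi.single_apply, hij'] using congrFun h i.succ
  have hxM : Matrix.vecMul x M = M i.succ i.succ • x :=
    vecMul_single_sub_single hM0 (Fin.succ_ne_zero i) (Fin.succ_ne_zero j) hdiag hzero
  have hiter : ∀ t : ℕ, (fun x => Matrix.vecMul x M)^[t] x = M i.succ i.succ ^ t • x := by
    intro t
    induction t with
    | zero => simp
    | succ t ih =>
      rw [Function.iterate_succ_apply', ih, Matrix.smul_vecMul, hxM, smul_smul, pow_succ]
  have hiter0 : ∀ t : ℕ, (fun x => Matrix.vecMul x M)^[t] 0 = 0 :=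
    Function.iterate_fixed (Matrix.zero_vecMul M)
  obtain ⟨t, -, ht⟩ := hexp x 0 hx0 0
  apply ht
  rw [hiter, hiter0]
  simp [hx]
end

section
/- Let G be the directed graph on vertex set {0,1,2,3} with arc set {(0,1),(1,0),(0,2),(2,0),(0,3),(3,0),(1,1),(2,2)}. Then: (i) for every q ≥ 2 there exists an expansive automata network f : [q]^4 → [q]^4 whose interaction graph is G; (ii) there exists a finite abelian group A of order q and an expansive additive group endomorphism of A^4 whose interaction graph is G if and only if q ≢ 2 (mod 4). -/
/-- The graph on `{0,1,2,3}` with arc set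
`{(0,1),(1,0),(0,2),(2,0),(0,3),(3,0),(1,1),(2,2)}`. -/
def Ggraph : Fin 4 → Fin 4 → Prop :=
  fun i j => (i = 0 ∧ j ≠ 0) ∨ (j = 0 ∧ i ≠ 0) ∨ (i = j ∧ (i = 1 ∨ i = 2))

/-- `f` is an expansive network over `α` whose interaction graph is `Ggraph`. -/
def IsExpansiveOnG {α : Type*} (f : (Fin 4 → α) → (Fin 4 → α)) : Prop :=
  (∀ u v : Fin 4, hasArc f u v ↔ Ggraph u v) ∧ Expansive f

section Transport

variable {α β : Type*}

/-- Conjugate of a network by a bijection of alphabets. -/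
def conjNetwork (e : α ≃ β) (f : (Fin 4 → α) → (Fin 4 → α)) (x : Fin 4 → β) : Fin 4 → β :=
  fun v => e (f (fun i => e.symm (x i)) v)

lemma conjNetwork_iterate (e : α ≃ β) (f : (Fin 4 → α) → (Fin 4 → α)) (t : ℕ) (x : Fin 4 → β) :
    (conjNetwork e f)^[t] x = fun v => e (f^[t] (fun i => e.symm (x i)) v) := by
  induction t with
  | zero => simp
  | succ t ih =>
    rw [Function.iterate_succ_apply', ih]
    funext v
    simp [conjNetwork, Function.iterate_succ_apply']

lemma IsExpansiveOnG.conj {f : (Fin 4 → α) → (Fin 4 → α)} (hf : IsExpansiveOnG f) (e : α ≃ β) :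
    IsExpansiveOnG (conjNetwork e f) := by
  refine ⟨fun u v => ?_, fun x y hxy v => ?_⟩
  · rw [← hf.1 u v]
    constructor
    · rintro ⟨a, b, hab, h⟩
      exact ⟨fun i => e.symm (a i), fun i => e.symm (b i), fun w hw => by simp only [hab w hw],
        fun hval => h (congrArg e hval)⟩
    · rintro ⟨a, b, hab, h⟩
      exact ⟨fun i => e (a i), fun i => e (b i), fun w hw => by simp only [hab w hw],
        fun hval => h (by simpa [conjNetwork] using hval)⟩
  · have hne : (fun i => e.symm (x i)) ≠ fun i => e.symm (y i) := fun h =>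
      hxy (funext fun i => e.symm.injective (congrFun h i))
    obtain ⟨t, ht, h⟩ := hf.2 _ _ hne v
    exact ⟨t, ht, fun hval => h (by simpa [conjNetwork_iterate] using hval)⟩

/-- Parallel composition of two networks. -/
def prodNetwork (f : (Fin 4 → α) → (Fin 4 → α)) (g : (Fin 4 → β) → (Fin 4 → β))
    (x : Fin 4 → α × β) : Fin 4 → α × β :=
  fun v => (f (fun i => (x i).1) v, g (fun i => (x i).2) v)

lemma prodNetwork_iterate (f : (Fin 4 → α) → (Fin 4 → α)) (g : (Fin 4 → β) → (Fin 4 → β))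
    (t : ℕ) (x : Fin 4 → α × β) :
    (prodNetwork f g)^[t] x =
      fun v => (f^[t] (fun i => (x i).1) v, g^[t] (fun i => (x i).2) v) := by
  induction t with
  | zero => simp
  | succ t ih =>
    rw [Function.iterate_succ_apply', ih]
    funext v
    simp [prodNetwork, Function.iterate_succ_apply']

lemma IsExpansiveOnG.prod {f : (Fin 4 → α) → (Fin 4 → α)} {g : (Fin 4 → β) → (Fin 4 → β)}
    (hf : IsExpansiveOnG f) (hg : IsExpansiveOnG g) [Nonempty β] :
    IsExpansiveOnG (prodNetwork f g) := by
  refine ⟨fun u v => ⟨?_, fun h => ?_⟩, fun x y hxy v => ?_⟩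
  · rintro ⟨a, b, hab, h⟩
    by_cases h1 : f (fun i => (a i).1) v = f (fun i => (b i).1) v
    · exact (hg.1 u v).1 ⟨_, _, fun w hw => by rw [hab w hw], fun h2 => h (Prod.ext h1 h2)⟩
    · exact (hf.1 u v).1 ⟨_, _, fun w hw => by rw [hab w hw], h1⟩
  · obtain ⟨a, b, hab, hne⟩ := (hf.1 u v).2 h
    have c : β := Classical.arbitrary β
    exact ⟨fun i => (a i, c), fun i => (b i, c), fun w hw => by simp only [hab w hw],
      fun hval => hne (congrArg Prod.fst hval)⟩
  · by_cases h1 : (fun i => (x i).1) = fun i => (y i).1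
    · have h2 : (fun i => (x i).2) ≠ fun i => (y i).2 := fun h2 =>
        hxy (funext fun i => Prod.ext (congrFun h1 i) (congrFun h2 i))
      obtain ⟨t, ht, h⟩ := hg.2 _ _ h2 v
      exact ⟨t, ht, fun hval => h (by simpa using congrArg Prod.snd (by
        simpa only [prodNetwork_iterate] using hval))⟩
    · obtain ⟨t, ht, h⟩ := hf.2 _ _ h1 v
      exact ⟨t, ht, fun hval => h (by simpa using congrArg Prod.fst (by
        simpa only [prodNetwork_iterate] using hval))⟩

end Transport

section Linear

variable {R : Type*} [CommRing R]

/-- The linear network on `Ggraph` with loop weights `u` and `1`, all other weights being `1`. -/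
def linearNetwork (u : R) (x : Fin 4 → R) : Fin 4 → R :=
  ![x 1 + x 2 + x 3, x 0 + u * x 1, x 0 + x 2, x 0]

lemma linearNetwork_add (u : R) (x y : Fin 4 → R) :
    linearNetwork u (x + y) = linearNetwork u x + linearNetwork u y := by
  funext v
  fin_cases v <;> simp [linearNetwork] <;> ring

lemma linearNetwork_sub (u : R) (x y : Fin 4 → R) :
    linearNetwork u (x - y) = linearNetwork u x - linearNetwork u y := by
  rw [eq_sub_iff_add_eq, ← linearNetwork_add, sub_add_cancel]

lemma linearNetwork_iterate_sub (u : R) (t : ℕ) (x y : Fin 4 → R) :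
    (linearNetwork u)^[t] (x - y) = (linearNetwork u)^[t] x - (linearNetwork u)^[t] y := by
  induction t with
  | zero => rfl
  | succ t ih => simp only [Function.iterate_succ_apply', ih, linearNetwork_sub]

lemma hasArc_linearNetwork [Nontrivial R] {u : R} (hu : IsUnit u) (i j : Fin 4) :
    hasArc (linearNetwork u) i j ↔ Ggraph i j := by
  constructor
  · rintro ⟨a, b, hab, h⟩
    by_contra hG
    apply h
    have H : ∀ w, Ggraph w j → a w = b w := fun w hw => hab w (by rintro rfl; exact hG hw)
    fin_cases j
    · simp [linearNetwork, H 1 (by simp [Ggraph]), H 2 (by simp [Ggraph]), H 3 (by simp [Ggraph])]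
    · simp [linearNetwork, H 0 (by simp [Ggraph]), H 1 (by simp [Ggraph])]
    · simp [linearNetwork, H 0 (by simp [Ggraph]), H 2 (by simp [Ggraph])]
    · simp [linearNetwork, H 0 (by simp [Ggraph])]
  · intro hG
    refine ⟨Pi.single i 1, 0, fun w hw => by simp [hw], ?_⟩
    have := hu.ne_zero
    fin_cases i <;> fin_cases j <;> simp_all [linearNetwork, Ggraph]

/-- A difference sequence of the linear network vanishing at one node vanishes identically. -/
lemma eq_zero_of_linearNetwork_iterate {u : R} (hu : IsUnit u) (hpred : IsUnit (u - 1))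
    (z : Fin 4 → R) (v : Fin 4) (h : ∀ t, 1 ≤ t → (linearNetwork u)^[t] z v = 0) : z = 0 := by
  set D : ℕ → Fin 4 → R := fun t => (linearNetwork u)^[t] z with hD
  have hs : ∀ t, D (t + 1) = linearNetwork u (D t) := fun t =>
    Function.iterate_succ_apply' _ _ _
  have e0 : ∀ t, D (t + 1) 0 = D t 1 + D t 2 + D t 3 := fun t => by rw [hs]; rfl
  have e1 : ∀ t, D (t + 1) 1 = D t 0 + u * D t 1 := fun t => by rw [hs]; rfl
  have e2 : ∀ t, D (t + 1) 2 = D t 0 + D t 2 := fun t => by rw [hs]; rfl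
  have e3 : ∀ t, D (t + 1) 3 = D t 0 := fun t => by rw [hs]; rfl
  have h0 : ∀ t, D (t + 1) 0 = 0 := by
    intro t
    fin_cases v
    · exact h _ (by omega)
    · have a := h (t + 1) (by omega)
      have b := h (t + 2) (by omega)
      have c := e1 (t + 1)
      simp only [hD] at *
      simp_all
    · have a := h (t + 1) (by omega)
      have b := h (t + 2) (by omega)
      have c := e2 (t + 1)
      simp only [hD] at *
      simp_all
    · exact (e3 (t + 1)).symm.trans (h (t + 2) (by omega))
  have back : ∀ t, D (t + 1) = 0 → D t = 0 := by
    intro t ht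
    have a0 : D t 0 = 0 := by rw [← e3, ht]; rfl
    have a1 : D t 1 = 0 := by
      have := e1 t
      rw [ht, a0] at this
      exact (hu.mul_right_eq_zero).1 (by simpa using this.symm)
    have a2 : D t 2 = 0 := by
      have := e2 t
      rw [ht, a0] at this
      simpa using this.symm
    have a3 : D t 3 = 0 := by
      have := e0 t
      rw [ht, a1, a2] at this
      simpa using this.symm
    funext i
    fin_cases i <;> assumption
  have z3 : D 2 3 = 0 := by rw [e3, h0]
  have z3' : D 3 3 = 0 := by rw [e3, h0]
  have s2 : D 2 1 + D 2 2 = 0 := by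
    have := e0 2
    rw [h0, z3, add_zero] at this
    exact this.symm
  have s3 : u * D 2 1 + D 2 2 = 0 := by
    have := e0 3
    rw [h0, z3', add_zero, e1, e2, h0, zero_add, zero_add] at this
    exact this.symm
  have z1 : D 2 1 = 0 := hpred.mul_right_eq_zero.1 (by linear_combination s3 - s2)
  have z2 : D 2 2 = 0 := by rwa [z1, zero_add] at s2
  have : D 2 = 0 := by
    funext i
    fin_cases i
    · exact h0 1
    · exact z1
    · exact z2
    · exact z3
  exact back 0 (back 1 this)

lemma isExpansiveOnG_linearNetwork [Nontrivial R] {u : R} (hu : IsUnit u)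
    (hpred : IsUnit (u - 1)) : IsExpansiveOnG (linearNetwork u) := by
  refine ⟨hasArc_linearNetwork hu, fun x y hxy v => ?_⟩
  by_contra! h
  refine hxy (sub_eq_zero.1 (eq_zero_of_linearNetwork_iterate hu hpred _ v fun t ht => ?_))
  rw [linearNetwork_iterate_sub, Pi.sub_apply, h t ht, sub_self]

end Linear

lemma isUnit_two_zmod {m : ℕ} (hm : Odd m) : IsUnit (2 : ZMod m) := by
  have := (ZMod.isUnit_iff_coprime 2 m).2 (Nat.coprime_two_left.2 hm)
  simpa using this

/-- Unless `q ≡ 2 (mod 4)`, some commutative ring of order `q` contains two consecutive units. -/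
lemma exists_commRing_consecutive_units {q : ℕ} (hq : q ≠ 0) (h4 : q % 4 ≠ 2) :
    ∃ (R : Type) (_ : CommRing R) (_ : Fintype R) (u : R),
      Fintype.card R = q ∧ IsUnit u ∧ IsUnit (u - 1) := by
  by_cases hodd : Odd q
  · have : NeZero q := ⟨hq⟩
    exact ⟨ZMod q, inferInstance, inferInstance, 2, ZMod.card q, isUnit_two_zmod hodd, by norm_num⟩
  · obtain ⟨k, m, hm, rfl⟩ := Nat.exists_eq_two_pow_mul_odd hq
    have hk : 2 ≤ k := by
      by_contra! hk
      interval_cases k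
      · simp [hm] at hodd
      · obtain ⟨r, rfl⟩ := hm
        omega
    have : NeZero m := ⟨by rintro rfl; simp at hq⟩
    have : Fact (Nat.Prime 2) := ⟨Nat.prime_two⟩
    have hcard : Nat.card (GaloisField 2 k) = 2 ^ k := GaloisField.card 2 k (by omega)
    have : Fintype (GaloisField 2 k) := Fintype.ofFinite _
    have hc : 2 < Fintype.card (GaloisField 2 k) := by
      rw [← Nat.card_eq_fintype_card, hcard]
      calc 2 < 2 ^ 2 := by norm_num
        _ ≤ 2 ^ k := Nat.pow_le_pow_right (by norm_num) hk
    obtain ⟨w, hw0, hw1⟩ : ∃ w : GaloisField 2 k, w ≠ 0 ∧ w ≠ 1 := by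
      classical
      obtain ⟨w, hw⟩ := Finset.exists_mem_notMem_of_card_lt_card
        (s := {0, 1}) (t := (Finset.univ : Finset (GaloisField 2 k)))
        ((Finset.card_le_two).trans_lt (by simpa using hc))
      exact ⟨w, by simpa using hw⟩
    refine ⟨GaloisField 2 k × ZMod m, inferInstance, inferInstance, (w, 2), ?_, ?_, ?_⟩
    · rw [Fintype.card_prod, ← Nat.card_eq_fintype_card, hcard, ZMod.card]
    · exact Prod.isUnit_iff.2 ⟨hw0.isUnit, isUnit_two_zmod hm⟩
    · exact Prod.isUnit_iff.2 ⟨(sub_ne_zero.2 hw1).isUnit, by norm_num⟩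

/-- A nonlinear network on `Ggraph` over the two-letter alphabet. -/
def boolNetwork (x : Fin 4 → Bool) : Fin 4 → Bool :=
  ![xor (x 3) (x 1 || x 2), xor (x 0) (x 1), !(xor (x 0) (x 2)), x 0]

lemma boolNetwork_separates (v : Fin 4) (x y : Fin 4 → Bool)
    (h : ∀ t < 7, boolNetwork^[t + 1] x v = boolNetwork^[t + 1] y v) : x = y := by
  have key : ∀ v : Fin 4, ∀ a b c d a' b' c' d' : Bool,
      (∀ t < 7, boolNetwork^[t + 1] ![a, b, c, d] v = boolNetwork^[t + 1] ![a', b', c', d'] v) →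
      (a = a' ∧ b = b' ∧ c = c' ∧ d = d') := by
    decide
  have hx : ∀ x : Fin 4 → Bool, x = ![x 0, x 1, x 2, x 3] := fun x => by
    funext i; fin_cases i <;> rfl
  rw [hx x, hx y] at h
  obtain ⟨h0, h1, h2, h3⟩ := key _ _ _ _ _ _ _ _ _ h
  funext i
  fin_cases i <;> assumption

lemma isExpansiveOnG_boolNetwork : IsExpansiveOnG boolNetwork := by
  refine ⟨fun i j => ⟨?_, fun hG => ?_⟩, fun x y hxy v => ?_⟩
  · rintro ⟨a, b, hab, h⟩
    by_contra hG
    apply h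
    have H : ∀ w, Ggraph w j → a w = b w := fun w hw => hab w (by rintro rfl; exact hG hw)
    fin_cases j
    · simp [boolNetwork, H 1 (by simp [Ggraph]), H 2 (by simp [Ggraph]), H 3 (by simp [Ggraph])]
    · simp [boolNetwork, H 0 (by simp [Ggraph]), H 1 (by simp [Ggraph])]
    · simp [boolNetwork, H 0 (by simp [Ggraph]), H 2 (by simp [Ggraph])]
    · simp [boolNetwork, H 0 (by simp [Ggraph])]
  · refine ⟨Function.update (fun _ => false) i true, fun _ => false, fun w hw => by simp [hw], ?_⟩
    fin_cases i <;> fin_cases j <;> simp_all [boolNetwork, Ggraph]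
  · by_contra! h
    exact hxy (boolNetwork_separates v x y fun t _ => h (t + 1) (by omega))

lemma exists_isExpansiveOnG_fin {q : ℕ} (hq : 2 ≤ q) :
    ∃ f : (Fin 4 → Fin q) → (Fin 4 → Fin q), IsExpansiveOnG f := by
  suffices h : ∃ (α : Type) (_ : Fintype α) (f : (Fin 4 → α) → (Fin 4 → α)),
      Fintype.card α = q ∧ IsExpansiveOnG f by
    obtain ⟨α, _, f, hc, hf⟩ := h
    exact ⟨_, hf.conj (Fintype.equivFinOfCardEq hc)⟩
  by_cases h4 : q % 4 = 2
  · obtain ⟨m, rfl⟩ : ∃ m, q = 2 * m := ⟨q / 2, by omega⟩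
    obtain rfl | hm : m = 1 ∨ 2 ≤ m := by omega
    · exact ⟨Bool, inferInstance, boolNetwork, rfl, isExpansiveOnG_boolNetwork⟩
    · obtain ⟨R, _, _, u, hc, hu, hpred⟩ :=
        exists_commRing_consecutive_units (q := m) (by omega) (by omega)
      have : Nontrivial R := Fintype.one_lt_card_iff_nontrivial.1 (by omega)
      exact ⟨Bool × R, inferInstance, _, by simp [hc],
        isExpansiveOnG_boolNetwork.prod (isExpansiveOnG_linearNetwork hu hpred)⟩
  · obtain ⟨R, _, _, u, hc, hu, hpred⟩ := exists_commRing_consecutive_units (by omega) h4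
    have : Nontrivial R := Fintype.one_lt_card_iff_nontrivial.1 (by omega)
    exact ⟨R, inferInstance, _, hc, isExpansiveOnG_linearNetwork hu hpred⟩

/-- An abelian group of order `≡ 2 (mod 4)` has exactly one element of order two. -/
lemma exists_unique_two_torsion {A : Type*} [AddCommGroup A] [Fintype A]
    (h4 : Fintype.card A % 4 = 2) :
    ∃ s : A, s ≠ 0 ∧ s + s = 0 ∧ ∀ a : A, a + a = 0 → a = 0 ∨ a = s := by
  have : Fact (Nat.Prime 2) := ⟨Nat.prime_two⟩
  obtain ⟨s, hs⟩ := exists_prime_addOrderOf_dvd_card (G := A) 2 (by omega)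
  have hss : s + s = 0 := by rw [← two_nsmul, ← hs]; exact addOrderOf_nsmul_eq_zero s
  have hs0 : s ≠ 0 := by rintro rfl; simp at hs
  refine ⟨s, hs0, hss, fun a ha => ?_⟩
  have hH : Nat.card (AddSubgroup.zmultiples s) = 2 := by rw [Nat.card_zmultiples, hs]
  have hcard := AddSubgroup.card_eq_card_quotient_mul_card_addSubgroup (AddSubgroup.zmultiples s)
  rw [hH, Nat.card_eq_fintype_card] at hcard
  set n := Nat.card (A ⧸ AddSubgroup.zmultiples s)
  have hodd : Nat.Coprime 2 n := Nat.coprime_two_left.2 (Nat.odd_iff.2 (by omega))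
  have h1 : addOrderOf (a : A ⧸ AddSubgroup.zmultiples s) ∣ 2 := by
    apply addOrderOf_dvd_of_nsmul_eq_zero
    rw [← QuotientAddGroup.mk_nsmul, two_nsmul, ha, QuotientAddGroup.mk_zero]
  have h2 : addOrderOf (a : A ⧸ AddSubgroup.zmultiples s) ∣ n := addOrderOf_dvd_natCard _
  have h3 := AddMonoid.addOrderOf_eq_one_iff.1 (Nat.eq_one_of_dvd_coprimes hodd h1 h2)
  rw [QuotientAddGroup.eq_zero_iff, AddSubgroup.mem_zmultiples_iff] at h3
  obtain ⟨k, rfl⟩ := h3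
  have hs2 : (2 : ℤ) • s = 0 := by rw [two_zsmul, hss]
  obtain ⟨r, rfl⟩ | ⟨r, rfl⟩ := Int.even_or_odd k
  · left; rw [← two_mul, mul_comm, mul_zsmul, hs2, zsmul_zero]
  · right; rw [add_zsmul, mul_comm, mul_zsmul, hs2, zsmul_zero, zero_add, one_zsmul]

/-- No expansive abelian network on `Ggraph` exists over a group with a unique element of
order two. -/
lemma not_isExpansiveOnG_of_unique_two_torsion {A : Type*} [AddCommGroup A] {s : A}
    (hs0 : s ≠ 0) (hss : s + s = 0) (hs : ∀ a : A, a + a = 0 → a = 0 ∨ a = s)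
    {f : (Fin 4 → A) → (Fin 4 → A)} (hadd : ∀ x y, f (x + y) = f x + f y) :
    ¬ IsExpansiveOnG f := by
  rintro ⟨hG, hexp⟩
  have f0 : f 0 = 0 := by simpa using hadd 0 0
  have inj : ∀ x y, f x = f y → x = y := by
    intro x y h
    by_contra hne
    obtain ⟨t, ht, hval⟩ := hexp x y hne 0
    obtain ⟨t, rfl⟩ : ∃ r, t = r + 1 := ⟨t - 1, by omega⟩
    exact hval (by rw [Function.iterate_succ_apply, Function.iterate_succ_apply, h])
  have nofix : ∀ z : Fin 4 → A, z 0 = 0 → f z = z → z = 0 := by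
    intro z hz hfz
    by_contra hne
    obtain ⟨t, -, hval⟩ := hexp z 0 hne 0
    rw [Function.iterate_fixed hfz, Function.iterate_fixed f0] at hval
    exact hval hz
  set p : Fin 4 → (Fin 4 → A) := fun i => Pi.single i s with hp
  have pne : ∀ i, p i ≠ 0 := fun i h => hs0 (by simpa [hp] using congrFun h i)
  have noarc : ∀ i j, ¬ Ggraph i j → f (p i) j = 0 := by
    intro i j hij
    by_contra h
    exact hij ((hG i j).1 ⟨p i, 0, fun w hw => by simp [hp, hw], by simpa [f0] using h⟩)
  have tors : ∀ i j, f (p i) j = 0 ∨ f (p i) j = s := by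
    intro i j
    refine hs _ ?_
    have : p i + p i = 0 := by rw [hp, ← Pi.single_add, hss, Pi.single_zero]
    rw [← Pi.add_apply, ← hadd, this, f0, Pi.zero_apply]
  have f3 : f (p 3) = p 0 := by
    have h1 := noarc 3 1 (by simp [Ggraph])
    have h2 := noarc 3 2 (by simp [Ggraph])
    have h3 := noarc 3 3 (by simp [Ggraph])
    rcases tors 3 0 with h | h
    · refine absurd (inj _ _ (Eq.trans ?_ f0.symm)) (pne 3)
      funext i; fin_cases i <;> assumption
    · funext i; fin_cases i <;> simpa [hp]
  have loop : ∀ i : Fin 4, i = 1 ∨ i = 2 → f (p i) = p i ∨ f (p i) = p 0 + p i := by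
    intro i hi
    have hoff : ∀ j, j ≠ 0 → j ≠ i → f (p i) j = 0 := fun j hj hji =>
      noarc i j (by rcases hi with rfl | rfl <;> simp [Ggraph, hj, hji.symm])
    have hi0 : i ≠ 0 := by rcases hi with rfl | rfl <;> decide
    have hi3 : i ≠ 3 := by rcases hi with rfl | rfl <;> decide
    rcases tors i i with hl | hl
    · exfalso
      rcases tors i 0 with h | h
      · refine pne i (inj _ _ (Eq.trans ?_ f0.symm))
        funext j
        by_cases hj : j = 0
        · rw [hj, h]; rfl
        · by_cases hji : j = i
          · rw [hji, hl]; rfl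
          · exact hoff j hj hji
      · have : p i = p 3 := by
          refine inj _ _ (Eq.trans ?_ f3.symm)
          funext j
          by_cases hj : j = 0
          · rw [hj, h]; simp [hp]
          · by_cases hji : j = i
            · rw [hji, hl]; simp [hp, hi0]
            · rw [hoff j hj hji]; simp [hp, hj]
        have := congrFun this 3
        simp [hp, hi3.symm] at this
        exact hs0 this.symm
    · refine (tors i 0).imp (fun h => ?_) (fun h => ?_) <;>
      · funext j
        by_cases hj : j = 0
        · rw [hj, h]; simp [hp, hi0.symm]
        · by_cases hji : j = i
          · rw [hji, hl]; simp [hp, hi0]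
          · rw [hoff j hj hji]; simp [hp, hj, hji]
  rcases loop 1 (Or.inl rfl) with h1 | h1
  · exact pne 1 (nofix _ (by simp [hp]) h1)
  rcases loop 2 (Or.inr rfl) with h2 | h2
  · exact pne 2 (nofix _ (by simp [hp]) h2)
  have hz : f (p 1 + p 2) = p 1 + p 2 := by
    have : p 0 + p 0 = 0 := by rw [hp, ← Pi.single_add, hss, Pi.single_zero]
    rw [hadd, h1, h2, add_add_add_comm, this, zero_add]
  have := congrFun (nofix _ (by simp [hp]) hz) 1
  simp [hp] at this
  exact hs0 this

/-- Proposition: (i) for every `q ≥ 2` the graph `G` admits an expansive automata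
network over the alphabet `[q]`; (ii) `G` admits an expansive abelian network (an
additive endomorphism of `A^4` for some finite abelian group `A` of order `q`) if
and only if `q ≢ 2 (mod 4)`. -/
theorem stmt_12 :
    (∀ q : ℕ, 2 ≤ q → ∃ f : (Fin 4 → Fin q) → (Fin 4 → Fin q),
      (∀ u v : Fin 4, hasArc f u v ↔ Ggraph u v) ∧ Expansive f) ∧
    (∀ q : ℕ, 2 ≤ q →
      ((∃ (A : Type) (_ : AddCommGroup A) (_ : Fintype A), Fintype.card A = q ∧
          ∃ f : (Fin 4 → A) → (Fin 4 → A),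
            (∀ x y : Fin 4 → A, f (x + y) = f x + f y) ∧
            (∀ u v : Fin 4, hasArc f u v ↔ Ggraph u v) ∧ Expansive f)
        ↔ q % 4 ≠ 2)) := by
  refine ⟨fun q hq => exists_isExpansiveOnG_fin hq, fun q hq => ⟨?_, fun h4 => ?_⟩⟩
  · rintro ⟨A, _, _, rfl, f, hadd, hf⟩ h4
    obtain ⟨s, hs0, hss, hs⟩ := exists_unique_two_torsion h4
    exact not_isExpansiveOnG_of_unique_two_torsion hs0 hss hs hadd hf
  · obtain ⟨R, _, _, u, hc, hu, hpred⟩ := exists_commRing_consecutive_units (by omega) h4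
    have : Nontrivial R := Fintype.one_lt_card_iff_nontrivial.1 (by omega)
    exact ⟨R, inferInstance, inferInstance, hc, linearNetwork u, linearNetwork_add u,
      isExpansiveOnG_linearNetwork hu hpred⟩
end

section
/- Let f : [q]^n → [q]^n be a strongly expansive automata network, i.e. f is expansive and T(f) = n. Then for every node v ∈ [n] and every x ∈ [q]^n there exists y ≠ x with τ_v(x,y) = n; that is, f^t(y)_v = f^t(x)_v for all 1 ≤ t ≤ n−1 but f^n(y)_v ≠ f^n(x)_v. -/
/-- `τ_v(x,y)`: the least `t ≥ 1` with `f^t(x)_v ≠ f^t(y)_v`. -/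
noncomputable def tau {m : ℕ} {α : Type*} (f : (Fin m → α) → (Fin m → α))
    (v : Fin m) (x y : Fin m → α) : ℕ :=
  sInf {t : ℕ | 1 ≤ t ∧ f^[t] x v ≠ f^[t] y v}

/-- The expansion time `T(f)`: the maximum of `τ_v(x,y)` over all nodes `v` and all
pairs of distinct configurations `x, y`. -/
noncomputable def Texp {m : ℕ} {α : Type*} (f : (Fin m → α) → (Fin m → α)) : ℕ :=
  sSup {k : ℕ | ∃ (v : Fin m) (x y : Fin m → α), x ≠ y ∧ k = tau f v x y}

/-- The trace of `v` over the first `n` steps. -/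
def trace {m : ℕ} {α : Type*} (f : (Fin m → α) → (Fin m → α)) (v : Fin m) (n : ℕ)
    (x : Fin m → α) : Fin n → α :=
  fun i => f^[i + 1] x v

theorem tau_le_Texp {m : ℕ} {α : Type*} [Finite α] (f : (Fin m → α) → (Fin m → α))
    (v : Fin m) {x y : Fin m → α} (hxy : x ≠ y) : tau f v x y ≤ Texp f := by
  refine le_csSup (Set.Finite.bddAbove ?_) ⟨v, x, y, hxy, rfl⟩
  refine (Set.finite_range
    (fun p : Fin m × (Fin m → α) × (Fin m → α) => tau f p.1 p.2.1 p.2.2)).subset ?_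
  rintro k ⟨v, x, y, -, rfl⟩
  exact ⟨(v, x, y), rfl⟩

theorem Expansive.trace_injective {m : ℕ} {α : Type*} [Finite α]
    {f : (Fin m → α) → (Fin m → α)} (hf : Expansive f) (v : Fin m) :
    Function.Injective (trace f v (Texp f)) := by
  intro x y h
  by_contra hxy
  obtain ⟨h1, hne⟩ : tau f v x y ∈ {t : ℕ | 1 ≤ t ∧ f^[t] x v ≠ f^[t] y v} :=
    Nat.sInf_mem (hf x y hxy v)
  have hle := tau_le_Texp f v hxy
  have := congrFun h ⟨tau f v x y - 1, by omega⟩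
  simp only [trace, Nat.sub_add_cancel h1] at this
  exact hne this

/-- Proposition: if `f : [q]^n → [q]^n` is strongly expansive (expansive with
`T(f) = n`), then for every node `v` and every configuration `x` there exists `y ≠ x`
with `τ_v(x,y) = n`, i.e. `f^t(y)_v = f^t(x)_v` for all `1 ≤ t ≤ n-1` but
`f^n(y)_v ≠ f^n(x)_v`. -/
theorem stmt_13 (n q : ℕ) (hn : 1 ≤ n) (hq : 2 ≤ q)
    (f : (Fin n → Fin q) → (Fin n → Fin q))
    (hexp : Expansive f) (hT : Texp f = n) :
    ∀ (v : Fin n) (x : Fin n → Fin q), ∃ y : Fin n → Fin q, y ≠ x ∧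
      tau f v x y = n ∧
      (∀ t : ℕ, 1 ≤ t → t < n → f^[t] y v = f^[t] x v) ∧
      f^[n] y v ≠ f^[n] x v := by
  intro v x
  have hinj : Function.Injective (trace f v n) := by
    have := hexp.trace_injective v
    rwa [hT] at this
  have : Nontrivial (Fin q) := Fin.nontrivial_iff_two_le.2 hq
  obtain ⟨c, hc⟩ := exists_ne (f^[n] x v)
  let last : Fin n := ⟨n - 1, by omega⟩
  obtain ⟨y, hy⟩ := Finite.surjective_of_injective hinj
    (Function.update (trace f v n x) last c)
  have heq : ∀ t : ℕ, 1 ≤ t → t < n → f^[t] y v = f^[t] x v := by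
    intro t h1 ht
    have h := congrFun hy ⟨t - 1, by omega⟩
    rw [Function.update_of_ne (by simp only [last, ne_eq, Fin.mk.injEq]; omega)] at h
    simpa only [trace, Nat.sub_add_cancel h1] using h
  have hne : f^[n] y v ≠ f^[n] x v := by
    have h := congrFun hy last
    rw [Function.update_self] at h
    simp only [trace, last, Nat.sub_add_cancel hn] at h
    rwa [h]
  refine ⟨y, fun h => hne (by rw [h]), ?_, heq, hne⟩
  refine le_antisymm (Nat.sInf_le ⟨hn, hne.symm⟩) (le_csInf ⟨n, hn, hne.symm⟩ ?_)
  rintro t ⟨h1, ht⟩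
  by_contra! hlt
  exact ht (heq t h1 hlt).symm
end

section
/- Let q ≥ 2 and n ≥ 2. Then: (i) every expansive automata network f : [q]^n → [q]^n has expansion time T(f) ≤ q^n − 2; (ii) there exists an expansive automata network f : [q]^n → [q]^n with T(f) ≥ q^n − q − 1. -/
/-! ### The upper bound -/

/-- The family `1, c (f(x)_v), c (f²(x)_v), …` of functions on configurations, the constant
function taking the place of time `0`. -/
def observable {m : ℕ} {α K : Type*} [One K] (f : (Fin m → α) → (Fin m → α)) (v : Fin m)
    (c : α → K) (t : ℕ) (x : Fin m → α) : K :=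
  if t = 0 then 1 else c (f^[t] x v)

/-- `|X|` functions on `X` that all have sum zero are linearly dependent. -/
theorem not_linearIndependent_of_sum_eq_zero {X K ι : Type*} [Fintype X] [Nonempty X] [Fintype ι]
    [Field K] (hcard : Fintype.card ι = Fintype.card X) (u : ι → X → K)
    (hu : ∀ i, ∑ x, u i x = 0) : ¬ LinearIndependent K u := by
  classical
  intro hli
  have : Nonempty ι := Fintype.card_pos_iff.1 (hcard ▸ Fintype.card_pos)
  have htop := hli.span_eq_top_of_card_eq_finrank (by simp [hcard])
  let S : (X → K) →ₗ[K] K := ∑ x, LinearMap.proj x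
  have hS : ∀ w, S w = ∑ x, w x := fun w => by simp [S]
  have hle : Submodule.span K (Set.range u) ≤ LinearMap.ker S := by
    rw [Submodule.span_le]
    rintro _ ⟨i, rfl⟩
    simp [hS, hu]
  have x₀ : X := Classical.arbitrary X
  have hmem : Pi.single x₀ (1 : K) ∈ LinearMap.ker S := hle (htop ▸ Submodule.mem_top)
  simp [hS] at hmem

theorem sum_observable_eq_zero {q n : ℕ} (hn : 2 ≤ n) {K : Type*} [Field K]
    (hK : (q : K) = 0) {f : (Fin n → Fin q) → (Fin n → Fin q)} (hf : Function.Injective f)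
    (v : Fin n) (c : Fin q → K) (t : ℕ) : ∑ x, observable f v c t x = 0 := by
  rcases eq_or_ne t 0 with rfl | ht
  · simp [observable, hK, show n ≠ 0 by omega]
  · simp only [observable, ht, if_false]
    rw [(Finite.injective_iff_bijective.1 (hf.iterate t)).sum_comp (fun x => c (x v)),
      ← Fintype.piFinset_univ, Fintype.sum_piFinset_apply]
    simp [hK, show n - 1 ≠ 0 by omega]

theorem Expansive.exists_le {q n : ℕ} (hq : 2 ≤ q) (hn : 2 ≤ n)
    {f : (Fin n → Fin q) → (Fin n → Fin q)} (hf : Expansive f) {x y : Fin n → Fin q}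
    (hxy : x ≠ y) (v : Fin n) :
    ∃ t, 1 ≤ t ∧ t ≤ q ^ n - 2 ∧ f^[t] x v ≠ f^[t] y v := by
  classical
  by_contra! h
  have : Fact q.minFac.Prime := ⟨Nat.minFac_prime (by omega)⟩
  let K := AlgebraicClosure (ZMod q.minFac)
  have hK : (q : K) = 0 := (CharP.cast_eq_zero_iff K q.minFac q).2 q.minFac_dvd
  let c : Fin q → K := fun a => Infinite.natEmbedding K a
  have hc : Function.Injective c := (Infinite.natEmbedding K).injective.comp Fin.val_injective
  have : Nonempty (Fin n → Fin q) := ⟨x⟩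
  have hdep := not_linearIndependent_of_sum_eq_zero (ι := Fin (q ^ n)) (by simp)
    (fun i => observable f v c i) fun i => sum_observable_eq_zero hn hK (hf.injective v) v c i
  obtain ⟨g, hg, hne⟩ := Fintype.not_linearIndependent_iff.1 hdep
  obtain ⟨s, hs, hmax⟩ := (Finset.univ.filter (g · ≠ 0)).exists_max_image id
    (by simpa [Finset.Nonempty] using hne)
  simp only [Finset.mem_filter, Finset.mem_univ, true_and, id] at hs hmax
  have hzero : ∀ i, s < i → g i = 0 := fun i hi => by
    by_contra hgi
    exact absurd (hmax i hgi) (not_le.2 hi)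
  have heval : ∀ z, ∑ i, g i * observable f v c i z = 0 := fun z => by
    simpa using congrFun hg z
  have hs0 : (s : ℕ) ≠ 0 := by
    intro h0
    have := heval x
    rw [Finset.sum_eq_single s (fun i _ hi => by
      rw [hzero i (lt_of_le_of_ne (by simp [Fin.le_def, h0]) hi.symm), zero_mul]) (by simp)] at this
    simp [observable, h0, hs] at this
  have hagree : ∀ t, 1 ≤ t → f^[t] x v = f^[t] y v := by
    intro t
    induction t using Nat.strong_induction_on with
    | _ t ih =>
      intro ht
      by_cases hle : t ≤ q ^ n - 2
      · exact h t ht hle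
      obtain ⟨j, rfl⟩ : ∃ j, t = s + j := ⟨t - s, by have := s.isLt; omega⟩
      have hdiff : ∑ i, g i * (observable f v c i (f^[j] x) - observable f v c i (f^[j] y)) = 0 := by
        simp [mul_sub, heval]
      rw [Finset.sum_eq_single s ?_ (by simp)] at hdiff
      · have := (mul_eq_zero.1 hdiff).resolve_left hs
        simp only [observable, hs0, if_false, ← Function.iterate_add_apply] at this
        exact hc (sub_eq_zero.1 this)
      · intro i _ his
        rcases lt_or_gt_of_ne his with hlt | hgt
        · by_cases hi : (i : ℕ) = 0
          · simp [observable, hi]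
          · simp only [observable, hi, if_false, ← Function.iterate_add_apply]
            rw [ih (i + j) (by have : (i : ℕ) < s := hlt; omega) (by omega), sub_self, mul_zero]
        · rw [hzero i hgt, zero_mul]
  obtain ⟨t, ht, hne'⟩ := hf x y hxy v
  exact hne' (hagree t ht)

theorem Expansive.tau_le {q n : ℕ} (hq : 2 ≤ q) (hn : 2 ≤ n)
    {f : (Fin n → Fin q) → (Fin n → Fin q)} (hf : Expansive f) {x y : Fin n → Fin q}
    (hxy : x ≠ y) (v : Fin n) : tau f v x y ≤ q ^ n - 2 := by
  obtain ⟨t, ht, hle, h⟩ := hf.exists_le hq hn hxy v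
  have hmem : t ∈ {t : ℕ | 1 ≤ t ∧ f^[t] x v ≠ f^[t] y v} := ⟨ht, h⟩
  exact (Nat.sInf_le hmem).trans hle

theorem Expansive.tau_le_Texp {q n : ℕ} (hq : 2 ≤ q) (hn : 2 ≤ n)
    {f : (Fin n → Fin q) → (Fin n → Fin q)} (hf : Expansive f) {x y : Fin n → Fin q}
    (hxy : x ≠ y) (v : Fin n) : tau f v x y ≤ Texp f := by
  have hbdd : BddAbove {k | ∃ v x y, x ≠ y ∧ k = tau f v x y} := by
    refine ⟨q ^ n - 2, ?_⟩
    rintro _ ⟨v, x, y, hxy, rfl⟩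
    exact hf.tau_le hq hn hxy v
  exact le_csSup hbdd ⟨v, x, y, hxy, rfl⟩

/-! ### The lower bound -/

/-- The permutation of `X ≃ Option A` that translates `A` by `e` and fixes the extra point. -/
def translation {X A : Type*} [Add A] (Φ : X ≃ Option A) (e : A) (x : X) : X :=
  Φ.symm ((Φ x).map (· + e))

theorem translation_iterate {X A : Type*} [AddCommMonoid A] (Φ : X ≃ Option A) (e : A) (t : ℕ)
    (x : X) : (translation Φ e)^[t] x = Φ.symm ((Φ x).map (· + t • e)) := by
  induction t with
  | zero => simp
  | succ t ih =>
    rw [Function.iterate_succ_apply', ih]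
    cases h : Φ x <;> simp [translation, succ_nsmul, add_assoc]

theorem card_filter_apply_eq {q n : ℕ} (v : Fin n) (a : Fin q) :
    (Finset.univ.filter fun x : Fin n → Fin q => x v = a).card = q ^ (n - 1) := by
  have := Fintype.card_filter_piFinset_const_eq_of_mem (Finset.univ : Finset (Fin q)) v
    (Finset.mem_univ a)
  simpa using this

theorem expansive_translation {q n L : ℕ} [NeZero q] [NeZero L]
    (Φ : (Fin n → Fin q) ≃ Option (ZMod L)) (e : ZMod L) (hqe : (q : ZMod L) * e = 1)
    (hfix : ∀ v, Φ.symm none v ≠ 0) : Expansive (translation Φ e) := by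
  have hsurj : ∀ s : ZMod L, ∃ t : ℕ, 1 ≤ t ∧ t • e = s := fun s => by
    refine ⟨((q : ZMod L) * s).val + L, by have := NeZero.pos L; omega, ?_⟩
    simp only [nsmul_eq_mul, Nat.cast_add, ZMod.natCast_val, ZMod.cast_id', id, CharP.cast_eq_zero,
      add_zero]
    linear_combination s * hqe
  have hmixed : ∀ (b : ZMod L) (v : Fin n), ∃ t : ℕ, 1 ≤ t ∧
      Φ.symm (some (b + t • e)) v ≠ Φ.symm none v := fun b v => by
    obtain ⟨a, ha⟩ : ∃ a, Φ (fun _ => 0) = some a := by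
      refine Option.ne_none_iff_exists'.1 fun h => hfix v ?_
      rw [← h, Equiv.symm_apply_apply]
    obtain ⟨t, ht, hte⟩ := hsurj (a - b)
    refine ⟨t, ht, ?_⟩
    rw [hte, add_sub_cancel, ← ha, Equiv.symm_apply_apply]
    exact (hfix v).symm
  intro x y hxy v
  simp only [translation_iterate]
  cases hx : Φ x with
  | none =>
    cases hy : Φ y with
    | none => exact absurd (Φ.injective (hx.trans hy.symm)) hxy
    | some b =>
      obtain ⟨t, ht, h⟩ := hmixed b v
      exact ⟨t, ht, h.symm⟩
  | some a =>
    cases hy : Φ y with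
    | none => exact hmixed a v
    | some b =>
      by_contra! h
      apply hxy
      apply Φ.injective
      rw [hx, hy]
      have hper : ∀ s, Φ.symm (some s) v = Φ.symm (some (s + (b - a))) v := fun s => by
        obtain ⟨t, ht, hte⟩ := hsurj (s - a)
        have := h t ht
        simp only [hte, Option.map_some] at this
        rwa [add_sub_cancel, show b + (s - a) = s + (b - a) by ring] at this
      let S : Finset (ZMod L) := Finset.univ.filter fun s => Φ.symm (some s) v = 0
      have hS : S.card = q ^ (n - 1) := by
        rw [← card_filter_apply_eq v (0 : Fin q)]
        refine Finset.card_bij (fun s _ => Φ.symm (some s)) ?_ ?_ ?_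
        · intro s hs
          simpa [S] using hs
        · intro s _ s' _ hss
          simpa using hss
        · intro z hz
          cases hz' : Φ z with
          | none =>
            refine absurd ?_ (hfix v)
            rw [← hz', Equiv.symm_apply_apply]
            simpa using hz
          | some s =>
            have hzs : Φ.symm (some s) = z := by rw [← hz', Equiv.symm_apply_apply]
            exact ⟨s, by simpa [S, hzs] using hz, hzs⟩
      have hsum : ∑ s ∈ S, (s + (b - a)) = ∑ s ∈ S, s :=
        Finset.sum_equiv (Equiv.addRight (b - a)) (fun s => by simp [S, ← hper s]) (by simp)
      rw [Finset.sum_add_distrib, add_eq_left, Finset.sum_const, hS, nsmul_eq_mul] at hsum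
      have hunit : IsUnit ((q ^ (n - 1) : ℕ) : ZMod L) := by
        rw [Nat.cast_pow]
        exact (IsUnit.of_mul_eq_one _ hqe).pow _
      rw [sub_eq_zero.1 (hunit.mul_right_eq_zero.1 hsum)]

/-- Configurations as base-`q` expansions of `0, …, L`, the largest number `L = qⁿ - 1` being
split off. -/
noncomputable def digitsEquiv {q n L : ℕ} [NeZero L] (h : q ^ n = L + 1) :
    (Fin n → Fin q) ≃ Option (ZMod L) :=
  finFunctionFinEquiv.trans <| (finCongr h).trans <| finSuccEquivLast.trans <|
    Equiv.optionCongr (ZMod.finEquiv L).toEquiv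

theorem digitsEquiv_symm_some {q n L : ℕ} [NeZero L] (h : q ^ n = L + 1) (a : ZMod L) (v : Fin n) :
    ((digitsEquiv h).symm (some a) v : ℕ) = a.val / q ^ (v : ℕ) % q := by
  obtain ⟨m, rfl⟩ := Nat.exists_eq_succ_of_ne_zero (NeZero.ne L)
  simp only [digitsEquiv, Equiv.symm_trans_apply]
  rw [finFunctionFinEquiv_symm_apply_val]
  simp only [← Equiv.optionCongr_symm, Equiv.optionCongr_apply, Option.map_some,
    finSuccEquivLast_symm_some]
  rfl

theorem digitsEquiv_symm_none {q n L : ℕ} [NeZero L] (h : q ^ n = L + 1) (v : Fin n) :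
    ((digitsEquiv h).symm none v : ℕ) = L / q ^ (v : ℕ) % q := by
  simp only [digitsEquiv, Equiv.symm_trans_apply]
  rw [finFunctionFinEquiv_symm_apply_val]
  simp only [← Equiv.optionCongr_symm, Equiv.optionCongr_apply, Option.map_none,
    finSuccEquivLast_symm_none]
  rfl

theorem pow_sub_one_div_pow_mod {q n v L : ℕ} (hq : 2 ≤ q) (hv : v < n) (h : q ^ n = L + 1) :
    L / q ^ v % q ≠ 0 := by
  intro h0
  have hpos : 0 < q ^ v := by positivity
  obtain ⟨k, hk⟩ := Nat.dvd_of_mod_eq_zero h0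
  have hdiv := Nat.div_add_mod L (q ^ v)
  have hlt := Nat.mod_lt L hpos
  rw [hk, ← mul_assoc] at hdiv
  have hdvd : q ^ v * q ∣ L % q ^ v + 1 := by
    rw [← Nat.dvd_add_right (Dvd.intro k rfl), ← add_assoc, hdiv, ← h, ← pow_succ]
    exact pow_dvd_pow q hv
  have hle := Nat.le_of_dvd (Nat.succ_pos _) hdvd
  nlinarith [Nat.mul_le_mul_left (q ^ v) hq]

/-- The top digit of `t e mod L` is unchanged by adding `1` for `1 ≤ t < L - q`, where `e = q⁻¹`. -/
theorem div_eq_div_succ {q e L t r : ℕ} (hq : 2 ≤ q) (he : q * e = L + 1)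
    (ht : 1 ≤ t) (htL : t + q < L) (hr : r < L) (hmod : (t * e : ℤ) ≡ r [ZMOD L]) :
    r + 1 < L ∧ r / e = (r + 1) / e := by
  have hmul : (t : ℤ) ≡ q * r [ZMOD L] := by
    have h1 : (t : ℤ) ≡ q * (t * e) [ZMOD L] := by
      refine (Int.modEq_iff_dvd).2 ⟨t, ?_⟩
      have : (q * e : ℤ) = L + 1 := by exact_mod_cast he
      linear_combination (t : ℤ) * this
    exact h1.trans (hmod.mul_left q)
  have key : ∀ m : ℕ, m < q → ¬ ((r : ℤ) + 1 ≡ m * e [ZMOD L]) := by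
    intro m hm hcon
    have h1 : (q : ℤ) * (r + 1) ≡ m [ZMOD L] := by
      refine (hcon.mul_left q).trans ((Int.modEq_iff_dvd).2 ⟨-m, ?_⟩)
      have : (q * e : ℤ) = L + 1 := by exact_mod_cast he
      linear_combination -(m : ℤ) * this
    have h2 : (m : ℤ) ≡ t + q [ZMOD L] := by
      refine h1.symm.trans ?_
      rw [mul_add, mul_one]
      exact (hmul.symm).add_right _
    have h3 := h2.dvd
    have := Int.le_of_dvd (by omega) h3
    omega
  have hr1 : r + 1 < L := by
    refine lt_of_le_of_ne hr fun h => key 0 (by omega) ?_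
    refine (Int.modEq_iff_dvd).2 ⟨-1, ?_⟩
    have : (r : ℤ) + 1 = L := by exact_mod_cast h
    simp [this]
  refine ⟨hr1, ?_⟩
  rw [Nat.succ_div, if_neg, add_zero]
  rintro ⟨m, hm⟩
  refine key m ?_ ?_
  · by_contra! hqm
    have := Nat.mul_le_mul_right e hqm
    rw [mul_comm m e, ← hm, he] at this
    omega
  · have : (r : ℤ) + 1 = e * m := by exact_mod_cast hm
    rw [this, mul_comm]

theorem exists_expansive_le_Texp {q n : ℕ} (hq : 2 ≤ q) (hn : 2 ≤ n) :
    ∃ f : (Fin n → Fin q) → (Fin n → Fin q), Expansive f ∧ q ^ n - q - 1 ≤ Texp f := by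
  obtain ⟨k, rfl⟩ : ∃ k, n = k + 1 := ⟨n - 1, by omega⟩
  have h4 : 4 ≤ q ^ (k + 1) := by
    calc 4 = 2 ^ 2 := rfl
      _ ≤ q ^ 2 := Nat.pow_le_pow_left hq 2
      _ ≤ q ^ (k + 1) := Nat.pow_le_pow_right (by omega) hn
  obtain ⟨L, hL⟩ : ∃ L, q ^ (k + 1) = L + 1 := ⟨q ^ (k + 1) - 1, by omega⟩
  have : NeZero L := ⟨by omega⟩
  have : NeZero q := ⟨by omega⟩
  have : Fact (1 < L) := ⟨by omega⟩
  have he : q * q ^ k = L + 1 := by rw [← hL, pow_succ']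
  let e : ZMod L := ((q ^ k : ℕ) : ZMod L)
  have hexp : Expansive (translation (digitsEquiv hL) e) := by
    refine expansive_translation _ e ?_ fun v h => ?_
    · simp only [e]
      rw [← Nat.cast_mul, he]
      simp
    · have := congrArg Fin.val h
      rw [digitsEquiv_symm_none] at this
      exact pow_sub_one_div_pow_mod hq v.isLt hL (by simpa using this)
  refine ⟨_, hexp, ?_⟩
  have hxy : (digitsEquiv hL).symm (some 0) ≠ (digitsEquiv hL).symm (some 1) := by simp
  refine le_trans ?_ (hexp.tau_le_Texp hq hn hxy (Fin.last k))
  refine le_csInf (hexp _ _ hxy _) ?_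
  rintro t ⟨ht, hne⟩
  by_contra! hlt
  apply hne
  rw [translation_iterate, translation_iterate]
  simp only [Equiv.apply_symm_apply, Option.map_some]
  have hmod : (t * (q ^ k : ℕ) : ℤ) ≡ ((t • e : ZMod L).val : ℕ) [ZMOD L] := by
    rw [← ZMod.intCast_eq_intCast_iff]
    simp [e]
  obtain ⟨h1, h2⟩ := div_eq_div_succ hq he ht (by omega) (ZMod.val_lt (t • e)) hmod
  apply Fin.ext
  rw [digitsEquiv_symm_some, digitsEquiv_symm_some, zero_add, add_comm 1,
    ZMod.val_add_of_lt (by rwa [ZMod.val_one]), ZMod.val_one, Fin.val_last, h2]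

/-- Theorem: for `q ≥ 2` and `n ≥ 2`, (i) every expansive network
`f : [q]^n → [q]^n` has expansion time `T(f) ≤ qⁿ - 2`, and (ii) there exists an
expansive network `f : [q]^n → [q]^n` with `T(f) ≥ qⁿ - q - 1`. -/
theorem stmt_14 (q n : ℕ) (hq : 2 ≤ q) (hn : 2 ≤ n) :
    (∀ f : (Fin n → Fin q) → (Fin n → Fin q), Expansive f → Texp f ≤ q ^ n - 2) ∧
    (∃ f : (Fin n → Fin q) → (Fin n → Fin q), Expansive f ∧ q ^ n - q - 1 ≤ Texp f) := by
  refine ⟨fun f hf => ?_, exists_expansive_le_Texp hq hn⟩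
  refine csSup_le' ?_
  rintro _ ⟨v, x, y, hxy, rfl⟩
  exact hf.tau_le hq hn hxy v
end
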